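/- The normal coordinate ψ^{T₄} of the four-vertex ladder tree is finite in the toy model, with value independent of the external parameter: for every real c > 0, the limit as ε → 0⁺ of (I₄(c,ε) - I₁(c,ε)·I₃(c,ε) - ½·I₂(c,ε)² + I₁(c,ε)²·I₂(c,ε) - ¼·I₁(c,ε)⁴) equals π⁴/8. -/

import Mathlib

open MeasureTheory Real Filter

noncomputable section

/-- The toy-model integral `I₁(c,ε) = ∫₀^∞ y^{-ε}/(y+c) dy`. -/
def I1 (c ε : ℝ) : ℝ := ∫ y in Set.Ioi (0 : ℝ), y ^ (-ε) / (y + c)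

/-- The nested toy-model integral of the two-vertex ladder tree,
`I₂(c,ε) = ∫₀^∞ (y^{-ε}/(y+c)) I₁(y,ε) dy`. -/
def I2 (c ε : ℝ) : ℝ := ∫ y in Set.Ioi (0 : ℝ), (y ^ (-ε) / (y + c)) * I1 y ε
/-- The nested toy-model integral of the three-vertex ladder tree,
`I₃(c,ε) = ∫₀^∞ (y^{-ε}/(y+c)) I₂(y,ε) dy`. -/
def I3 (c ε : ℝ) : ℝ := ∫ y in Set.Ioi (0 : ℝ), (y ^ (-ε) / (y + c)) * I2 y ε

/-- The nested toy-model integral of the four-vertex ladder tree,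
`I₄(c,ε) = ∫₀^∞ (y^{-ε}/(y+c)) I₃(y,ε) dy`. -/
def I4 (c ε : ℝ) : ℝ := ∫ y in Set.Ioi (0 : ℝ), (y ^ (-ε) / (y + c)) * I3 y ε

lemma lintegral_rpow_mul_exp_neg_mul_Ioi {a r : ℝ} (ha : 0 < a) (hr : 0 < r) :
    ∫⁻ t in Set.Ioi (0 : ℝ), ENNReal.ofReal (t ^ (a - 1) * exp (-(r * t))) =
      ENNReal.ofReal ((1 / r) ^ a * Gamma a) := by
  have h := integral_rpow_mul_exp_neg_mul_Ioi ha hr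
  have hpos : 0 < (1 / r) ^ a * Gamma a := mul_pos (by positivity) (Gamma_pos_of_pos ha)
  rw [← h, ofReal_integral_eq_lintegral_ofReal]
  · exact not_imp_comm.1 integral_undef (h.trans_ne hpos.ne')
  · filter_upwards [ae_restrict_mem measurableSet_Ioi] with t ht
    have := rpow_nonneg (le_of_lt ht) (a - 1)
    simp only [Pi.zero_apply]
    positivity

lemma lintegral_rpow_neg_div_add {a c : ℝ} (ha : 0 < a) (ha1 : a < 1) (hc : 0 < c) :
    ∫⁻ y in Set.Ioi (0 : ℝ), ENNReal.ofReal (y ^ (-a) / (y + c)) =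
      ENNReal.ofReal (c ^ (-a) * (π / sin (π * a))) := by
  have hy : ∀ y ∈ Set.Ioi (0 : ℝ), ENNReal.ofReal (y ^ (-a) / (y + c)) =
      ∫⁻ t in Set.Ioi (0 : ℝ), ENNReal.ofReal (y ^ (-a) * exp (-((y + c) * t))) := by
    intro y hy
    rw [Set.mem_Ioi] at hy
    have h := lintegral_rpow_mul_exp_neg_mul_Ioi one_pos (add_pos hy hc)
    simp only [sub_self, rpow_zero, one_mul, rpow_one, Gamma_one, mul_one] at h
    simp_rw [ENNReal.ofReal_mul (rpow_nonneg hy.le (-a))]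
    rw [lintegral_const_mul _ (by fun_prop), h, ← ENNReal.ofReal_mul (rpow_nonneg hy.le _),
      mul_one_div]
  have ht : ∀ t ∈ Set.Ioi (0 : ℝ),
      ∫⁻ y in Set.Ioi (0 : ℝ), ENNReal.ofReal (y ^ (-a) * exp (-((y + c) * t))) =
        ENNReal.ofReal (Gamma (1 - a)) * ENNReal.ofReal (t ^ (a - 1) * exp (-(c * t))) := by
    intro t ht
    rw [Set.mem_Ioi] at ht
    have h := lintegral_rpow_mul_exp_neg_mul_Ioi (sub_pos.2 ha1) ht
    have hsplit : ∀ y : ℝ, y ^ (-a) * exp (-((y + c) * t)) =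
        exp (-(c * t)) * (y ^ (1 - a - 1) * exp (-(t * y))) := by
      intro y
      rw [show -((y + c) * t) = -(c * t) + -(t * y) by ring, exp_add,
        show 1 - a - 1 = -a by ring]
      ring
    simp_rw [hsplit, ENNReal.ofReal_mul (exp_pos (-(c * t))).le]
    rw [lintegral_const_mul _ (by fun_prop), h, ← ENNReal.ofReal_mul (exp_pos _).le,
      ← ENNReal.ofReal_mul (Gamma_pos_of_pos (sub_pos.2 ha1)).le, one_div, inv_rpow ht.le,
      ← rpow_neg ht.le, neg_sub]
    congr 1
    ring
  rw [setLIntegral_congr_fun measurableSet_Ioi hy, lintegral_lintegral_swap (by fun_prop),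
    setLIntegral_congr_fun measurableSet_Ioi ht, lintegral_const_mul _ (by fun_prop),
    lintegral_rpow_mul_exp_neg_mul_Ioi ha hc,
    ← ENNReal.ofReal_mul (Gamma_pos_of_pos (sub_pos.2 ha1)).le, ← Gamma_mul_Gamma_one_sub,
    one_div, inv_rpow hc.le, ← rpow_neg hc.le]
  congr 1
  ring

lemma integral_rpow_neg_div_add {a c : ℝ} (ha : 0 < a) (ha1 : a < 1) (hc : 0 < c) :
    ∫ y in Set.Ioi (0 : ℝ), y ^ (-a) / (y + c) = c ^ (-a) * (π / sin (π * a)) := by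
  rw [integral_eq_lintegral_of_nonneg_ae, lintegral_rpow_neg_div_add ha ha1 hc,
    ENNReal.toReal_ofReal]
  · rw [← Gamma_mul_Gamma_one_sub]
    have := Gamma_pos_of_pos ha
    have := Gamma_pos_of_pos (sub_pos.2 ha1)
    positivity
  · filter_upwards [ae_restrict_mem measurableSet_Ioi] with y hy
    rw [Set.mem_Ioi] at hy
    simp only [Pi.zero_apply]
    positivity
  · exact Measurable.aestronglyMeasurable (by fun_prop)

/-- One more rung on a ladder whose inner integral is `f y = y ^ (-b) * P`. -/
lemma integral_rpow_neg_div_add_mul {c ε b P : ℝ} {f : ℝ → ℝ} (hpos : 0 < ε + b)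
    (hlt : ε + b < 1) (hc : 0 < c) (hf : ∀ y, 0 < y → f y = y ^ (-b) * P) :
    ∫ y in Set.Ioi (0 : ℝ), (y ^ (-ε) / (y + c)) * f y =
      c ^ (-(ε + b)) * (P * (π / sin (π * (ε + b)))) := by
  have h : ∀ y ∈ Set.Ioi (0 : ℝ),
      (y ^ (-ε) / (y + c)) * f y = P * (y ^ (-(ε + b)) / (y + c)) := by
    intro y hy
    rw [hf y hy, neg_add, rpow_add hy]
    ring
  rw [setIntegral_congr_fun measurableSet_Ioi h, integral_const_mul,
    integral_rpow_neg_div_add hpos hlt hc]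
  ring

lemma I1_eq {c ε : ℝ} (hε : 0 < ε) (hlt : ε < 1) (hc : 0 < c) :
    I1 c ε = c ^ (-ε) * (π / sin (π * ε)) :=
  integral_rpow_neg_div_add hε hlt hc

lemma I2_eq {c ε : ℝ} (hε : 0 < ε) (hlt : 2 * ε < 1) (hc : 0 < c) :
    I2 c ε = c ^ (-(2 * ε)) * (π / sin (π * ε) * (π / sin (π * (2 * ε)))) := by
  have h := integral_rpow_neg_div_add_mul (c := c) (ε := ε) (f := fun y => I1 y ε)
    (by linarith) (by linarith) hc (fun y hy => I1_eq hε (by linarith) hy)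
  rwa [show ε + ε = 2 * ε by ring] at h

lemma I3_eq {c ε : ℝ} (hε : 0 < ε) (hlt : 3 * ε < 1) (hc : 0 < c) :
    I3 c ε = c ^ (-(3 * ε)) *
      (π / sin (π * ε) * (π / sin (π * (2 * ε))) * (π / sin (π * (3 * ε)))) := by
  have h := integral_rpow_neg_div_add_mul (c := c) (ε := ε) (f := fun y => I2 y ε)
    (by linarith) (by linarith) hc (fun y hy => I2_eq hε (by linarith) hy)
  rwa [show ε + 2 * ε = 3 * ε by ring] at h

lemma I4_eq {c ε : ℝ} (hε : 0 < ε) (hlt : 4 * ε < 1) (hc : 0 < c) :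
    I4 c ε = c ^ (-(4 * ε)) *
      (π / sin (π * ε) * (π / sin (π * (2 * ε))) * (π / sin (π * (3 * ε))) *
        (π / sin (π * (4 * ε)))) := by
  have h := integral_rpow_neg_div_add_mul (c := c) (ε := ε) (f := fun y => I3 y ε)
    (by linarith) (by linarith) hc (fun y hy => I3_eq hε (by linarith) hy)
  rwa [show ε + 3 * ε = 4 * ε by ring] at h

/-- In the normal coordinate the poles in `sin x` cancel, leaving a rational function of `cos x`
that is regular at `x = 0`. -/
lemma ladder_combination_eq {x : ℝ} (hx : 0 < x) (hlt : x < π / 4) (p : ℝ) :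
    p / sin x * (p / sin (2 * x)) * (p / sin (3 * x)) * (p / sin (4 * x))
      - p / sin x * (p / sin x * (p / sin (2 * x)) * (p / sin (3 * x)))
      - (1 / 2) * (p / sin x * (p / sin (2 * x))) ^ 2
      + (p / sin x) ^ 2 * (p / sin x * (p / sin (2 * x))) - (1 / 4) * (p / sin x) ^ 4 =
    p ^ 4 * (2 + 5 * cos x - 4 * cos x ^ 3) /
      (2 * cos x * (1 + cos x) ^ 2 * (4 * cos x ^ 2 - 1) * (2 * cos x ^ 2 - 1)) := by
  have hs : sin x ≠ 0 := (sin_pos_of_pos_of_lt_pi hx (by linarith)).ne'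
  have hC : 0 < cos x := cos_pos_of_mem_Ioo ⟨by linarith, by linarith⟩
  have hC2 : 0 < 2 * cos x ^ 2 - 1 := by
    rw [← cos_two_mul]
    exact cos_pos_of_mem_Ioo ⟨by linarith, by linarith⟩
  have hC3 : 0 < 4 * cos x ^ 2 - 1 := by linarith
  have h2 : sin (2 * x) = sin x * (2 * cos x) := by rw [sin_two_mul]; ring
  have h3 : sin (3 * x) = sin x * (4 * cos x ^ 2 - 1) := by
    rw [sin_three_mul, cos_sq']; ring
  have h4 : sin (4 * x) = sin x * (4 * cos x * (2 * cos x ^ 2 - 1)) := by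
    rw [show 4 * x = 2 * (2 * x) by ring, sin_two_mul, h2, cos_two_mul]; ring
  have hs4 : sin x ^ 4 = (1 - cos x ^ 2) ^ 2 := by rw [← sin_sq]; ring
  rw [h2, h3, h4]
  generalize cos x = C at *
  generalize sin x = s at *
  have hC' := hC.ne'
  have hC2' := hC2.ne'
  have hC3' := hC3.ne'
  have hC1 : 1 + C ≠ 0 := by positivity
  trans p ^ 4 * (-(16 * C ^ 6) + 32 * C ^ 5 + 4 * C ^ 4 - 32 * C ^ 3 + 4 * C ^ 2 + 8 * C) /
      (s ^ 4 * (8 * C ^ 2 * (4 * C ^ 2 - 1) * (2 * C ^ 2 - 1)))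
  · obtain ⟨A, hA⟩ : ∃ A, A = 4 * C ^ 2 - 1 := ⟨_, rfl⟩
    obtain ⟨B, hB⟩ : ∃ B, B = 2 * C ^ 2 - 1 := ⟨_, rfl⟩
    rw [← hA] at hC3' ⊢
    rw [← hB] at hC2' ⊢
    field_simp
    rw [hA, hB]
    ring
  · rw [div_eq_div_iff (by positivity) (by positivity), hs4]
    ring

lemma ladder_normal_coordinate_eq {c ε : ℝ} (hε : 0 < ε) (hlt : 4 * ε < 1) (hc : 0 < c) :
    I4 c ε - I1 c ε * I3 c ε - (1 / 2) * (I2 c ε) ^ 2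
        + (I1 c ε) ^ 2 * I2 c ε - (1 / 4) * (I1 c ε) ^ 4 =
      (c ^ (-ε)) ^ 4 * (π ^ 4 * (2 + 5 * cos (π * ε) - 4 * cos (π * ε) ^ 3) /
        (2 * cos (π * ε) * (1 + cos (π * ε)) ^ 2 * (4 * cos (π * ε) ^ 2 - 1) *
          (2 * cos (π * ε) ^ 2 - 1))) := by
  have hpow : ∀ n : ℕ, c ^ (-(n * ε)) = (c ^ (-ε)) ^ n := by
    intro n
    rw [← rpow_mul_natCast hc.le]
    ring_nf
  have h2 := hpow 2
  have h3 := hpow 3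
  have h4 := hpow 4
  push_cast at h2 h3 h4
  rw [← ladder_combination_eq (mul_pos pi_pos hε) (by nlinarith [pi_pos]),
    I1_eq hε (by linarith) hc, I2_eq hε (by linarith) hc, I3_eq hε (by linarith) hc, I4_eq hε hlt hc, h2, h3, h4,
    mul_left_comm π 2 ε, mul_left_comm π 3 ε, mul_left_comm π 4 ε]
  ring

/-- The normal coordinate
`ψ^{T₄} = φ^{T₄} - φ^{T₁}φ^{T₃} - ½(φ^{T₂})² + (φ^{T₁})²φ^{T₂} - ¼(φ^{T₁})⁴` of
the four-vertex ladder tree is finite in the toy model, with value independent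
of the external parameter:
`I₄ - I₁·I₃ - ½I₂² + I₁²·I₂ - ¼I₁⁴ → π⁴/8` as `ε → 0⁺`, for every `c > 0`. -/
theorem toy_model_psi4_finite (c : ℝ) (hc : 0 < c) :
    Tendsto (fun ε : ℝ =>
        I4 c ε - I1 c ε * I3 c ε - (1 / 2) * (I2 c ε) ^ 2
          + (I1 c ε) ^ 2 * I2 c ε - (1 / 4) * (I1 c ε) ^ 4)
      (nhdsWithin 0 (Set.Ioi 0)) (nhds (π ^ 4 / 8)) := by
  have hlim : ContinuousAt (fun ε : ℝ =>
      (c ^ (-ε)) ^ 4 * (π ^ 4 * (2 + 5 * cos (π * ε) - 4 * cos (π * ε) ^ 3) /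
        (2 * cos (π * ε) * (1 + cos (π * ε)) ^ 2 * (4 * cos (π * ε) ^ 2 - 1) *
          (2 * cos (π * ε) ^ 2 - 1)))) 0 := by
    refine ContinuousAt.mul ?_ (ContinuousAt.div (by fun_prop) (by fun_prop) (by norm_num))
    exact (ContinuousAt.rpow continuousAt_const (by fun_prop) (Or.inl hc.ne')).pow 4
  have h := hlim.tendsto.mono_left (nhdsWithin_le_nhds (s := Set.Ioi 0))
  have hval : (c ^ (-(0 : ℝ))) ^ 4 * (π ^ 4 * (2 + 5 * cos (π * 0) - 4 * cos (π * 0) ^ 3) /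
      (2 * cos (π * 0) * (1 + cos (π * 0)) ^ 2 * (4 * cos (π * 0) ^ 2 - 1) *
        (2 * cos (π * 0) ^ 2 - 1))) = π ^ 4 / 8 := by
    norm_num
    ring
  rw [hval] at h
  refine Tendsto.congr' ?_ h
  filter_upwards [Ioo_mem_nhdsGT (show (0 : ℝ) < 1 / 4 by norm_num)] with ε hε
  exact (ladder_normal_coordinate_eq hε.1 (by linarith [hε.2]) hc).symm

end
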